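/- Let n = 2, let ℓ ∈ {2d−2, 2d−1}, let m ≥ 0 be an integer, and let v ∈ ℤ³ have degree dm + ℓ. Then dim_K ℰ_{v,ℓ} ≥ d². If in addition F is nondegenerate and m+1 ≠ 0 in K, then dim_K ℰ_{v,ℓ} = b_ℓ + b_{ℓ−d} = d². -/

import Mathlib

noncomputable section

open MvPolynomial

/-- The finset `D_ℓ` of exponent vectors in `ℤ_{≥0}^{n+1}` of total degree `ℓ`,
realized as integer vectors. -/
def Dfin (n ℓ : ℕ) : Finset (Fin (n + 1) → ℤ) :=
  (Finset.Nat.antidiagonalTuple (n + 1) ℓ).image fun t i => (t i : ℤ)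

/-- The inverted simplex `D(v,ℓ) = {v - w : w ∈ D_ℓ}`. -/
def Dv {n : ℕ} (v : Fin (n + 1) → ℤ) (ℓ : ℕ) : Finset (Fin (n + 1) → ℤ) :=
  (Dfin n ℓ).image fun w => v - w

/-- The coefficient of a polynomial at an integer exponent vector (zero if some exponent
is negative). -/
def coeffZ {K : Type*} [Field K] {n : ℕ} (F : MvPolynomial (Fin (n + 1)) K)
    (u : Fin (n + 1) → ℤ) : K :=
  if ∀ i, 0 ≤ u i then
    MvPolynomial.coeff (Finsupp.equivFunOnFinite.symm fun i => (u i).toNat) F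
  else 0

/-- The linear functional
`G ↦ Σ_{t ∈ D_d} ((v_i - s_i) - (m+1)·t_i) · F_t · G_{v-s-t}`, i.e. the difference of the
two sides of the defining equation of `ℰ_{v,ℓ}` at `(s,i)`. -/
def eqFun {K : Type*} [Field K] {n : ℕ} (F : MvPolynomial (Fin (n + 1)) K) (d m : ℕ)
    (v s : Fin (n + 1) → ℤ) (i : Fin (n + 1)) : ((Fin (n + 1) → ℤ) →₀ K) →ₗ[K] K :=
  ∑ t ∈ Dfin n d,
    ((((v i - s i : ℤ) : K) - ((m : K) + 1) * ((t i : ℤ) : K)) * coeffZ F t) •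
      (Finsupp.lapply (v - s - t) : ((Fin (n + 1) → ℤ) →₀ K) →ₗ[K] K)

/-- The space `ℰ_{v,ℓ}`: Laurent polynomials `G` supported on `D(v,ℓ)` such that for every
`s ∈ D_{ℓ-d}` and every `i ∈ {0,…,n}`,
`(v_i - s_i) Σ_{t∈D_d} F_t G_{v-s-t} = (m+1) Σ_{t∈D_d} t_i F_t G_{v-s-t}`. -/
def Espace {K : Type*} [Field K] {n : ℕ} (F : MvPolynomial (Fin (n + 1)) K) (d m : ℕ)
    (v : Fin (n + 1) → ℤ) (ℓ : ℕ) : Submodule K ((Fin (n + 1) → ℤ) →₀ K) :=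
  Finsupp.supported K K ↑(Dv v ℓ) ⊓
    ⨅ s ∈ Dfin n (ℓ - d), ⨅ i : Fin (n + 1), LinearMap.ker (eqFun F d m v s i)

/-- Restriction `G|_S` of a Laurent polynomial to a finite set of monomials. -/
def restrictF {K : Type*} [Field K] {n : ℕ} (G : (Fin (n + 1) → ℤ) →₀ K)
    (S : Finset (Fin (n + 1) → ℤ)) : (Fin (n + 1) → ℤ) →₀ K :=
  ∑ u ∈ S, Finsupp.single u (G u)

/-- Restriction `F|_S` of a polynomial to a finite set of (integer) monomials, as a Laurent
polynomial. -/
def restrictPoly {K : Type*} [Field K] {n : ℕ} (F : MvPolynomial (Fin (n + 1)) K)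
    (S : Finset (Fin (n + 1) → ℤ)) : (Fin (n + 1) → ℤ) →₀ K :=
  ∑ u ∈ S, Finsupp.single u (coeffZ F u)

/-- The coefficient of the product `F·G` at the integer exponent vector `w`, where `F` is a
polynomial and `G` a Laurent polynomial. -/
def mulCoeffZ {K : Type*} [Field K] {n : ℕ} (F : MvPolynomial (Fin (n + 1)) K)
    (G : (Fin (n + 1) → ℤ) →₀ K) (w : Fin (n + 1) → ℤ) : K :=
  ∑ t ∈ F.support, MvPolynomial.coeff t F * G fun i => w i - (t i : ℤ)

/-- The ideal `I_F = ⟨∂_0F, …, ∂_nF⟩` where `∂_i = x_i ∂/∂x_i`. -/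
def partialIdeal {K : Type*} [Field K] {n : ℕ} (F : MvPolynomial (Fin (n + 1)) K) :
    Ideal (MvPolynomial (Fin (n + 1)) K) :=
  Ideal.span (Set.range fun i => X i * pderiv i F)

/-- `b_ℓ := dim_K K[x]_ℓ / (I_F)_ℓ`, the dimension of the degree-`ℓ` graded piece of
`K[x]/I_F`. -/
def bdim {K : Type*} [Field K] {n : ℕ} (F : MvPolynomial (Fin (n + 1)) K) (ℓ : ℕ) : ℕ :=
  Module.finrank K
    (Submodule.map (Ideal.Quotient.mkₐ K (partialIdeal F)).toLinearMap
      (homogeneousSubmodule (Fin (n + 1)) K ℓ))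

/-- The monomials `x^β`, `β ∈ B`, project to a `K`-basis of the degree-`ℓ` graded piece of
`K[x]/I_F`. -/
def IsMonomialBasis {K : Type*} [Field K] {n : ℕ} (F : MvPolynomial (Fin (n + 1)) K)
    (ℓ : ℕ) (B : Finset (Fin (n + 1) → ℕ)) : Prop :=
  LinearIndependent K (fun β : ↥B =>
      Ideal.Quotient.mk (partialIdeal F)
        (MvPolynomial.monomial
          (Finsupp.equivFunOnFinite.symm (β : Fin (n + 1) → ℕ)) (1 : K)))
  ∧ Submodule.span K (Set.range fun β : ↥B =>
      Ideal.Quotient.mk (partialIdeal F)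
        (MvPolynomial.monomial
          (Finsupp.equivFunOnFinite.symm (β : Fin (n + 1) → ℕ)) (1 : K)))
    = Submodule.map (Ideal.Quotient.mkₐ K (partialIdeal F)).toLinearMap
        (homogeneousSubmodule (Fin (n + 1)) K ℓ)

/-- If `x₁` divides `f₁`, `x₂` divides `f₂`, and powers of the `xᵢ` lie in `(f₀, f₁, f₂)`, then
`f₂` is a nonzerodivisor modulo `(f₀, f₁)`. -/
theorem mem_span_pair_of_mul_mem {R : Type*} [CommRing R] [IsDomain R]
    {x₀ x₁ x₂ f₀ f₁ f₂ a : R} (hx₂ : Prime x₂) (hP : (Ideal.span {x₁, x₂}).IsPrime)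
    (h₀ : x₀ ∉ Ideal.span {x₁, x₂}) (h₁ : ¬ x₂ ∣ x₁) (hf₁ : x₁ ∣ f₁) (hf₂ : x₂ ∣ f₂)
    (hx₀I : x₀ ∈ (Ideal.span {f₀, f₁, f₂}).radical)
    (hx₁I : x₁ ∈ (Ideal.span {f₀, f₁, f₂}).radical)
    (hx₂I : x₂ ∈ (Ideal.span {f₀, f₁, f₂}).radical)
    (ha : a * f₂ ∈ Ideal.span {f₀, f₁}) : a ∈ Ideal.span {f₀, f₁} := by
  have hx₁P : x₁ ∈ Ideal.span {x₁, x₂} := Ideal.subset_span (by simp)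
  have hx₂P : x₂ ∈ Ideal.span {x₁, x₂} := Ideal.subset_span (by simp)
  have hf₀ : f₀ ∉ Ideal.span {x₁, x₂} := by
    intro h
    obtain ⟨N, hN⟩ := hx₀I
    refine h₀ (hP.mem_of_pow_mem N (Ideal.span_le.2 ?_ hN))
    rintro _ (rfl | rfl | rfl)
    · exact h
    · exact Ideal.mem_of_dvd _ hf₁ hx₁P
    · exact Ideal.mem_of_dvd _ hf₂ hx₂P
  have hf₀' : ¬ x₂ ∣ f₀ := fun h => hf₀ (Ideal.mem_of_dvd _ h hx₂P)
  have cancel_x₁ : ∀ b, x₁ * b ∈ Ideal.span {f₀, x₂} → b ∈ Ideal.span {f₀, x₂} := by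
    intro b hb
    obtain ⟨p, r, h⟩ := Ideal.mem_span_pair.1 hb
    have hp : p ∈ Ideal.span {x₁, x₂} := by
      refine (hP.mem_or_mem (?_ : p * f₀ ∈ _)).resolve_right hf₀
      exact Ideal.mem_span_pair.2 ⟨b, -r, by linear_combination -h⟩
    obtain ⟨p', p'', rfl⟩ := Ideal.mem_span_pair.1 hp
    have : x₂ ∣ x₁ * (b - f₀ * p') := ⟨p'' * f₀ + r, by linear_combination -h⟩
    obtain ⟨c, hc⟩ := (hx₂.dvd_or_dvd this).resolve_left h₁
    exact Ideal.mem_span_pair.2 ⟨p', c, by linear_combination -hc⟩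
  have cancel_f₁ : ∀ q, q * f₁ ∈ Ideal.span {f₀, x₂} → q ∈ Ideal.span {f₀, x₂} := by
    intro q hq
    obtain ⟨N, hN⟩ := hx₁I
    have key : x₁ ^ N * q ∈ Ideal.span {f₀, x₂} := by
      have h : Ideal.span {f₀, f₁, f₂} * Ideal.span {q} ≤ Ideal.span {f₀, x₂} := by
        rw [Ideal.span_mul_span', Ideal.span_le]
        rintro _ ⟨y, hy, z, rfl, rfl⟩
        rcases hy with rfl | rfl | rfl
        · exact Ideal.mul_mem_right _ _ (Ideal.subset_span (by simp))
        · simpa only [mul_comm, SetLike.mem_coe] using hq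
        · exact Ideal.mul_mem_right _ _ (Ideal.mem_of_dvd _ hf₂ (Ideal.subset_span (by simp)))
      exact h (Ideal.mul_mem_mul hN (Ideal.mem_span_singleton_self q))
    clear hN
    induction N with
    | zero => simpa using key
    | succ N ih => exact ih (cancel_x₁ _ (by rwa [← mul_assoc, ← pow_succ']))
  have cancel_x₂ : ∀ a, x₂ * a ∈ Ideal.span {f₀, f₁} → a ∈ Ideal.span {f₀, f₁} := by
    intro a ha
    obtain ⟨p, q, h⟩ := Ideal.mem_span_pair.1 ha
    obtain ⟨c, q', hq⟩ := Ideal.mem_span_pair.1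
      (cancel_f₁ q (Ideal.mem_span_pair.2 ⟨-p, a, by linear_combination -h⟩))
    have : x₂ ∣ (p + c * f₁) * f₀ := ⟨a - q' * f₁, by linear_combination h + f₁ * hq⟩
    obtain ⟨p', hp'⟩ := (hx₂.dvd_or_dvd this).resolve_right hf₀'
    refine Ideal.mem_span_pair.2 ⟨p', q', mul_left_cancel₀ hx₂.ne_zero ?_⟩
    linear_combination h + f₁ * hq - f₀ * hp'
  obtain ⟨N, hN⟩ := hx₂I
  have key : x₂ ^ N * a ∈ Ideal.span {f₀, f₁} := by
    have h : Ideal.span {f₀, f₁, f₂} * Ideal.span {a} ≤ Ideal.span {f₀, f₁} := by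
      rw [Ideal.span_mul_span', Ideal.span_le]
      rintro _ ⟨y, hy, z, rfl, rfl⟩
      rcases hy with rfl | rfl | rfl
      · exact Ideal.mul_mem_right _ _ (Ideal.subset_span (by simp))
      · exact Ideal.mul_mem_right _ _ (Ideal.subset_span (by simp))
      · simpa only [mul_comm, SetLike.mem_coe] using ha
    exact h (Ideal.mul_mem_mul hN (Ideal.mem_span_singleton_self a))
  clear hN
  induction N with
  | zero => simpa using key
  | succ N ih => exact ih (cancel_x₂ _ (by rwa [← mul_assoc, ← pow_succ']))

theorem MvPolynomial.mem_span_X_image_iff_aeval_eq_zero {σ K : Type*} [CommRing K]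
    (s : Set σ) [DecidablePred (· ∈ s)] (p : MvPolynomial σ K) :
    p ∈ Ideal.span ((X : σ → MvPolynomial σ K) '' s) ↔
      aeval (fun i => if i ∈ s then (0 : MvPolynomial σ K) else X i) p = 0 := by
  set I := Ideal.span ((X : σ → MvPolynomial σ K) '' s)
  set φ : MvPolynomial σ K →ₐ[K] MvPolynomial σ K :=
    aeval fun i => if i ∈ s then (0 : MvPolynomial σ K) else X i
  constructor
  · have : I ≤ RingHom.ker φ := by
      refine Ideal.span_le.2 ?_
      rintro _ ⟨i, hi, rfl⟩
      simp [φ, hi]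
    exact fun h => this h
  · intro h
    have hφ : (Ideal.Quotient.mkₐ K I).comp φ = Ideal.Quotient.mkₐ K I := by
      ext i
      by_cases hi : i ∈ s
      · have : (X i : MvPolynomial σ K) ∈ I := Ideal.subset_span ⟨i, hi, rfl⟩
        simp [φ, hi, Ideal.Quotient.eq_zero_iff_mem.2 this]
      · simp [φ, hi]
    have := DFunLike.congr_fun hφ p
    simp only [AlgHom.comp_apply, h, map_zero, Ideal.Quotient.mkₐ_eq_mk] at this
    exact Ideal.Quotient.eq_zero_iff_mem.1 this.symm

theorem MvPolynomial.isPrime_span_X_image {σ K : Type*} [CommRing K] [IsDomain K] (s : Set σ) :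
    (Ideal.span ((X : σ → MvPolynomial σ K) '' s)).IsPrime := by
  classical
  have : Ideal.span ((X : σ → MvPolynomial σ K) '' s) = RingHom.ker
      (aeval fun i => if i ∈ s then (0 : MvPolynomial σ K) else X i :
        MvPolynomial σ K →ₐ[K] MvPolynomial σ K) :=
    Ideal.ext (mem_span_X_image_iff_aeval_eq_zero s)
  rw [this]
  exact RingHom.ker_isPrime _

theorem MvPolynomial.X_mem_radical_partialIdeal {K : Type*} [Field K] {n : ℕ}
    {F : MvPolynomial (Fin (n + 1)) K}
    (hF : ∀ x : Fin (n + 1) → AlgebraicClosure K,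
      (∀ i, aeval x (X i * pderiv i F) = 0) → x = 0) (i : Fin (n + 1)) :
    X i ∈ (partialIdeal F).radical := by
  rw [← vanishingIdeal_zeroLocus_eq_radical (K := AlgebraicClosure K), mem_vanishingIdeal_iff]
  intro x hx
  rw [partialIdeal, zeroLocus_span] at hx
  rw [hF x fun j => hx _ ⟨j, rfl⟩]
  simp

section HomogeneousComponents

attribute [local instance] MvPolynomial.gradedAlgebra

theorem MvPolynomial.homogeneousComponent_mul_of_lt {σ R : Type*} [CommSemiring R] {d k : ℕ}
    {f : MvPolynomial σ R} (hf : f.IsHomogeneous d) (h : k < d) (q : MvPolynomial σ R) :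
    homogeneousComponent k (q * f) = 0 := by
  have := DirectSum.coe_decompose_mul_of_right_mem_of_not_le (homogeneousSubmodule σ R)
    (a := q) hf (not_le.2 h)
  rwa [← decomposition.decompose'_apply]

theorem MvPolynomial.homogeneousComponent_mul_of_le {σ R : Type*} [CommSemiring R] {d k : ℕ}
    {f : MvPolynomial σ R} (hf : f.IsHomogeneous d) (h : d ≤ k) (q : MvPolynomial σ R) :
    homogeneousComponent k (q * f) = homogeneousComponent (k - d) q * f := by
  have := DirectSum.coe_decompose_mul_of_right_mem_of_le (homogeneousSubmodule σ R)
    (a := q) hf h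
  rwa [← decomposition.decompose'_apply, ← decomposition.decompose'_apply]

end HomogeneousComponents

theorem MvPolynomial.isHomogeneous_X_mul_pderiv {σ R : Type*} [CommSemiring R] {d : ℕ}
    (hd : d ≠ 0) {F : MvPolynomial σ R} (hF : F.IsHomogeneous d) (i : σ) :
    (X i * pderiv i F).IsHomogeneous d := by
  convert (isHomogeneous_X R i).mul hF.pderiv using 1
  omega

/-- For nondegenerate `F`, the logarithmic partial derivatives have no syzygies in degrees
below `d`. -/
theorem MvPolynomial.eq_zero_of_sum_mul_X_mul_pderiv_eq_zero {K : Type*} [Field K] {d e : ℕ}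
    (hed : e < d) {F : MvPolynomial (Fin (2 + 1)) K} (hF : F.IsHomogeneous d)
    (hnd : ∀ x : Fin (2 + 1) → AlgebraicClosure K,
      (∀ i, aeval x (X i * pderiv i F) = 0) → x = 0)
    {a : Fin (2 + 1) → MvPolynomial (Fin (2 + 1)) K} (ha : ∀ i, (a i).IsHomogeneous e)
    (h : ∑ i, a i * (X i * pderiv i F) = 0) (i : Fin (2 + 1)) : a i = 0 := by
  have key : ∀ i j k : Fin (2 + 1), i ≠ j → i ≠ k → j ≠ k → Finset.univ = {k, j, i} →
      a i = 0 := by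
    intro i j k hij hik hjk huniv
    have hI : partialIdeal F = Ideal.span {X k * pderiv k F, X j * pderiv j F,
        X i * pderiv i F} := by
      rw [partialIdeal, ← Set.image_univ, ← Finset.coe_univ, huniv]
      simp [Set.image_insert_eq]
    have hrad := hI ▸ X_mem_radical_partialIdeal hnd
    have hspan : Ideal.span {(X j : MvPolynomial (Fin (2 + 1)) K), X i} =
        Ideal.span (X '' {j, i}) := by rw [Set.image_pair]
    have hmem : a i ∈ Ideal.span {X k * pderiv k F, X j * pderiv j F} := by
      refine mem_span_pair_of_mul_mem (X_prime (i := i)) (x₀ := X k) (x₁ := X j)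
        (hspan ▸ isPrime_span_X_image _) ?_ ?_ (dvd_mul_right _ _) (dvd_mul_right _ _)
        (hrad k) (hrad j) (hrad i) ?_
      · rw [hspan, mem_span_X_image_iff_aeval_eq_zero]
        simp [hik.symm, hjk.symm]
      · rw [X_dvd_X]
        simp [hij]
      · refine Ideal.mem_span_pair.2 ⟨-a k, -a j, ?_⟩
        rw [huniv, Finset.sum_insert (by simp [hik.symm, hjk.symm]),
          Finset.sum_pair hij.symm] at h
        linear_combination -h
    obtain ⟨p, q, hpq⟩ := Ideal.mem_span_pair.1 hmem
    have hd : d ≠ 0 := by omega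
    rw [← homogeneousComponent_eq_self (ha i), ← hpq, map_add,
      homogeneousComponent_mul_of_lt (isHomogeneous_X_mul_pderiv hd hF _) hed,
      homogeneousComponent_mul_of_lt (isHomogeneous_X_mul_pderiv hd hF _) hed, add_zero]
  fin_cases i
  · exact key 0 1 2 (by decide) (by decide) (by decide) (by decide)
  · exact key 1 0 2 (by decide) (by decide) (by decide) (by decide)
  · exact key 2 0 1 (by decide) (by decide) (by decide) (by decide)

/-- The exponent vectors of total degree `k` in three variables. -/
abbrev ExpVec (k : ℕ) : Type :=
  ↥((Finset.univ : Finset (Fin (2 + 1))).finsuppAntidiag k)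

theorem ExpVec.degree_eq {k : ℕ} (s : ExpVec k) : s.1.degree = k := by
  have := (Finset.mem_finsuppAntidiag.1 s.2).1
  rwa [Finsupp.degree_eq_sum]

theorem mem_finsuppAntidiag_univ_iff {k : ℕ} {s : Fin (2 + 1) →₀ ℕ} :
    s ∈ (Finset.univ : Finset (Fin (2 + 1))).finsuppAntidiag k ↔ s.degree = k := by
  simp [Finset.mem_finsuppAntidiag, Finsupp.degree_eq_sum]

theorem two_mul_card_expVec (k : ℕ) : 2 * Fintype.card (ExpVec k) = (k + 1) * (k + 2) := by
  rw [Fintype.card_coe, Finset.card_finsuppAntidiag_nat_eq_choose, Finset.card_univ,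
    Fintype.card_fin, show 2 + 1 + k - 1 = k + 2 by omega, Nat.choose_symm_add,
    Nat.choose_two_right, Nat.mul_div_cancel' (Nat.even_mul_pred_self _).two_dvd]
  simp [mul_comm]

/-- The homogeneous polynomial with prescribed coefficients. -/
def homogeneousOfCoeffs (K : Type*) [Field K] (k : ℕ) :
    (ExpVec k → K) →ₗ[K] MvPolynomial (Fin (2 + 1)) K :=
  Fintype.linearCombination K fun s : ExpVec k => monomial s.1 1

theorem homogeneousOfCoeffs_apply {K : Type*} [Field K] {k : ℕ} (c : ExpVec k → K) :
    homogeneousOfCoeffs K k c = ∑ s, monomial s.1 (c s) := by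
  simp [homogeneousOfCoeffs, Fintype.linearCombination_apply, smul_monomial]

theorem coeff_homogeneousOfCoeffs {K : Type*} [Field K] {k : ℕ} (c : ExpVec k → K)
    (s : ExpVec k) : coeff s.1 (homogeneousOfCoeffs K k c) = c s := by
  classical
  simp [homogeneousOfCoeffs_apply, coeff_sum, coeff_monomial]

theorem homogeneousOfCoeffs_injective (K : Type*) [Field K] (k : ℕ) :
    Function.Injective (homogeneousOfCoeffs K k) := by
  intro c c' h
  ext s
  rw [← coeff_homogeneousOfCoeffs c, h, coeff_homogeneousOfCoeffs]

theorem isHomogeneous_homogeneousOfCoeffs {K : Type*} [Field K] {k : ℕ} (c : ExpVec k → K) :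
    (homogeneousOfCoeffs K k c).IsHomogeneous k := by
  rw [homogeneousOfCoeffs_apply]
  exact IsHomogeneous.sum _ _ _ fun s _ => isHomogeneous_monomial _ s.degree_eq

theorem range_homogeneousOfCoeffs (K : Type*) [Field K] (k : ℕ) :
    LinearMap.range (homogeneousOfCoeffs K k) = homogeneousSubmodule (Fin (2 + 1)) K k := by
  refine le_antisymm ?_ fun p hp => ⟨fun s => coeff s.1 p, ?_⟩
  · rintro _ ⟨c, rfl⟩
    exact isHomogeneous_homogeneousOfCoeffs c
  · ext t
    by_cases ht : t.degree = k
    · exact coeff_homogeneousOfCoeffs _ ⟨t, mem_finsuppAntidiag_univ_iff.2 ht⟩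
    · rw [(isHomogeneous_homogeneousOfCoeffs _).coeff_eq_zero ht, IsHomogeneous.coeff_eq_zero hp ht]

theorem finrank_homogeneousSubmodule (K : Type*) [Field K] (k : ℕ) :
    Module.finrank K (homogeneousSubmodule (Fin (2 + 1)) K k) = Fintype.card (ExpVec k) := by
  rw [← range_homogeneousOfCoeffs,
    LinearMap.finrank_range_of_inj (homogeneousOfCoeffs_injective K k),
    Module.finrank_fintype_fun_eq_card]

theorem bdim_add_finrank_inf {K : Type*} [Field K] (F : MvPolynomial (Fin (2 + 1)) K) (k : ℕ) :
    bdim F k + Module.finrank K ↥(homogeneousSubmodule (Fin (2 + 1)) K k ⊓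
      (partialIdeal F).restrictScalars K) = Fintype.card (ExpVec k) := by
  have hfin : Module.Finite K (homogeneousSubmodule (Fin (2 + 1)) K k) :=
    Module.Finite.iff_fg.2 (homogeneousSubmodule_fg _ _ k)
  set π := (Ideal.Quotient.mkₐ K (partialIdeal F)).toLinearMap
  have h := LinearMap.finrank_range_add_finrank_ker
    (π.domRestrict (homogeneousSubmodule (Fin (2 + 1)) K k))
  rw [LinearMap.range_domRestrict, finrank_homogeneousSubmodule] at h
  rw [← h, bdim]
  congr 1
  have hker : LinearMap.ker π = (partialIdeal F).restrictScalars K := by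
    ext p
    simp [π, Ideal.Quotient.eq_zero_iff_mem]
  rw [LinearMap.ker_domRestrict, hker, ← Submodule.map_comap_subtype]
  exact (Submodule.equivMapOfInjective _ (Submodule.injective_subtype _) _).finrank_eq.symm

theorem bdim_of_lt {K : Type*} [Field K] {d k : ℕ} (hk : k < d)
    {F : MvPolynomial (Fin (2 + 1)) K} (hF : F.IsHomogeneous d) :
    bdim F k = Fintype.card (ExpVec k) := by
  have hd : d ≠ 0 := by omega
  rw [← bdim_add_finrank_inf F k, left_eq_add]
  suffices h : homogeneousSubmodule (Fin (2 + 1)) K k ⊓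
      (partialIdeal F).restrictScalars K = ⊥ by
    rw [h, finrank_bot]
  rw [eq_bot_iff]
  rintro p ⟨hp, hpI⟩
  obtain ⟨c, rfl⟩ := (Ideal.mem_span_range_iff_exists_fun).1 hpI
  rw [Submodule.mem_bot, ← homogeneousComponent_eq_self hp, map_sum]
  exact Finset.sum_eq_zero fun i _ =>
    homogeneousComponent_mul_of_lt (isHomogeneous_X_mul_pderiv hd hF i) hk _

theorem bdim_add_three_mul {K : Type*} [Field K] {d e : ℕ} (hed : e < d)
    {F : MvPolynomial (Fin (2 + 1)) K} (hF : F.IsHomogeneous d)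
    (hnd : ∀ x : Fin (2 + 1) → AlgebraicClosure K,
      (∀ i, aeval x (X i * pderiv i F) = 0) → x = 0) :
    bdim F (e + d) + 3 * Fintype.card (ExpVec e) = Fintype.card (ExpVec (e + d)) := by
  have hd : d ≠ 0 := by omega
  rw [← bdim_add_finrank_inf F (e + d)]
  congr 1
  let θ : (Fin (2 + 1) → ExpVec e → K) →ₗ[K] MvPolynomial (Fin (2 + 1)) K :=
    ∑ i, (LinearMap.mulRight K (X i * pderiv i F)) ∘ₗ homogeneousOfCoeffs K e ∘ₗ
      LinearMap.proj i
  have hθ : ∀ c, θ c = ∑ i, homogeneousOfCoeffs K e (c i) * (X i * pderiv i F) := by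
    intro c
    simp [θ, mul_assoc]
  have hinj : Function.Injective θ := by
    rw [← LinearMap.ker_eq_bot, LinearMap.ker_eq_bot']
    intro c hc
    rw [hθ] at hc
    ext i : 1
    refine homogeneousOfCoeffs_injective K e ?_
    rw [Pi.zero_apply, map_zero]
    exact eq_zero_of_sum_mul_X_mul_pderiv_eq_zero hed hF hnd
      (fun i => isHomogeneous_homogeneousOfCoeffs (c i)) hc i
  have hrange : LinearMap.range θ = homogeneousSubmodule (Fin (2 + 1)) K (e + d) ⊓
      (partialIdeal F).restrictScalars K := by
    refine le_antisymm ?_ ?_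
    · rintro _ ⟨c, rfl⟩
      rw [hθ]
      refine ⟨IsHomogeneous.sum _ _ _ fun i _ => (isHomogeneous_homogeneousOfCoeffs (c i)).mul
        (isHomogeneous_X_mul_pderiv hd hF i), ?_⟩
      exact Ideal.sum_mem _ fun i _ => Ideal.mul_mem_left _ _ (Ideal.subset_span ⟨i, rfl⟩)
    · rintro p ⟨hp, hpI⟩
      obtain ⟨q, rfl⟩ := (Ideal.mem_span_range_iff_exists_fun).1 hpI
      have hq : ∀ i, ∃ c, homogeneousOfCoeffs K e c = homogeneousComponent e (q i) := fun i =>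
        (range_homogeneousOfCoeffs K e).ge (homogeneousComponent_mem e (q i))
      choose c hc using hq
      refine ⟨c, ?_⟩
      rw [hθ, ← homogeneousComponent_eq_self hp, map_sum]
      refine Finset.sum_congr rfl fun i _ => ?_
      rw [homogeneousComponent_mul_of_le (isHomogeneous_X_mul_pderiv hd hF i) (by omega), hc,
        Nat.add_sub_cancel]
  rw [← hrange, LinearMap.finrank_range_of_inj hinj, Module.finrank_pi_fintype]
  simp

theorem mem_Dfin_iff {n k : ℕ} {u : Fin (n + 1) → ℤ} :
    u ∈ Dfin n k ↔ (∀ i, 0 ≤ u i) ∧ ∑ i, u i = k := by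
  simp only [Dfin, Finset.mem_image, Finset.Nat.mem_antidiagonalTuple]
  constructor
  · rintro ⟨t, ht, rfl⟩
    exact ⟨fun i => Int.natCast_nonneg _, by rw [← ht]; push_cast; rfl⟩
  · rintro ⟨h0, hu⟩
    refine ⟨fun i => (u i).toNat, ?_, funext fun i => Int.toNat_of_nonneg (h0 i)⟩
    zify
    simpa [h0] using hu

/-- The exponent vector `s`, with integer entries. -/
def ExpVec.toInt {k : ℕ} (s : ExpVec k) : Fin (2 + 1) → ℤ := fun i => s.1 i

theorem ExpVec.toInt_injective {k : ℕ} : Function.Injective (ExpVec.toInt (k := k)) := by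
  intro s t h
  ext i
  exact Int.natCast_inj.1 (congrFun h i)

theorem ExpVec.sum_toInt {k : ℕ} (s : ExpVec k) : ∑ i, s.toInt i = k := by
  conv_rhs => rw [← s.degree_eq, Finsupp.degree_eq_sum]
  push_cast
  rfl

theorem coe_Dfin_eq_range (k : ℕ) :
    (Dfin 2 k : Set (Fin (2 + 1) → ℤ)) = Set.range (ExpVec.toInt (k := k)) := by
  ext u
  rw [Finset.mem_coe, mem_Dfin_iff]
  constructor
  · rintro ⟨h0, hu⟩
    refine ⟨⟨Finsupp.equivFunOnFinite.symm fun i => (u i).toNat, ?_⟩,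
      funext fun i => Int.toNat_of_nonneg (h0 i)⟩
    rw [mem_finsuppAntidiag_univ_iff, Finsupp.degree_eq_sum]
    zify
    simpa [h0] using hu
  · rintro ⟨s, rfl⟩
    exact ⟨fun i => Int.natCast_nonneg _, s.sum_toInt⟩

theorem coeffZ_toInt_sub {K : Type*} [Field K] (F : MvPolynomial (Fin (2 + 1)) K) {k l : ℕ}
    (s : ExpVec k) (w : ExpVec l) :
    coeffZ F (w.toInt - s.toInt) = if s.1 ≤ w.1 then coeff (w.1 - s.1) F else 0 := by
  have h : (∀ i, 0 ≤ (w.toInt - s.toInt) i) ↔ s.1 ≤ w.1 := by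
    simp [Finsupp.le_def, ExpVec.toInt]
  simp only [coeffZ, h]
  congr 2
  ext i
  simp [ExpVec.toInt]

/-- The matrix of the linear system cutting out `ℰ_{v,ℓ}`, where `ℓ = e + d`. -/
def eqMatrix {K : Type*} [Field K] (F : MvPolynomial (Fin (2 + 1)) K) (m e ℓ : ℕ)
    (v : Fin (2 + 1) → ℤ) : Matrix (ExpVec e × Fin (2 + 1)) (ExpVec ℓ) K :=
  Matrix.of fun si w =>
    (((v si.2 - si.1.toInt si.2 : ℤ) : K) -
      ((m : K) + 1) * ((w.toInt si.2 - si.1.toInt si.2 : ℤ) : K)) *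
        coeffZ F (w.toInt - si.1.toInt)

/-- The Laurent polynomial supported on `D(v,ℓ)` with prescribed coefficients. -/
def laurentOfCoeffs (K : Type*) [Field K] (v : Fin (2 + 1) → ℤ) (ℓ : ℕ) :
    (ExpVec ℓ → K) →ₗ[K] ((Fin (2 + 1) → ℤ) →₀ K) :=
  Finsupp.lmapDomain K K (fun w : ExpVec ℓ => v - w.toInt) ∘ₗ
    (Finsupp.linearEquivFunOnFinite K K (ExpVec ℓ)).symm.toLinearMap

theorem laurentOfCoeffs_injective (K : Type*) [Field K] (v : Fin (2 + 1) → ℤ) (ℓ : ℕ) :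
    Function.Injective (laurentOfCoeffs K v ℓ) :=
  (Finsupp.mapDomain_injective fun _ _ h => ExpVec.toInt_injective (sub_right_injective h)).comp
    (LinearEquiv.injective _)

theorem range_laurentOfCoeffs (K : Type*) [Field K] (v : Fin (2 + 1) → ℤ) (ℓ : ℕ) :
    LinearMap.range (laurentOfCoeffs K v ℓ) = Finsupp.supported K K ↑(Dv v ℓ) := by
  rw [laurentOfCoeffs, LinearMap.range_comp, LinearEquiv.range, Dv, Finset.coe_image,
    coe_Dfin_eq_range, ← Set.range_comp, ← Finsupp.supported_univ,
    Finsupp.lmapDomain_supported, Set.image_univ]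
  rfl

theorem eqFun_laurentOfCoeffs {K : Type*} [Field K] (F : MvPolynomial (Fin (2 + 1)) K)
    (d m e : ℕ) (v : Fin (2 + 1) → ℤ) (s : ExpVec e) (i : Fin (2 + 1))
    (g : ExpVec (e + d) → K) :
    eqFun F d m v s.toInt i (laurentOfCoeffs K v (e + d) g) =
      (eqMatrix F m e (e + d) v).mulVec g (s, i) := by
  suffices h : eqFun F d m v s.toInt i ∘ₗ laurentOfCoeffs K v (e + d) =
      LinearMap.proj (s, i) ∘ₗ (eqMatrix F m e (e + d) v).mulVecLin from
    DFunLike.congr_fun h g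
  refine LinearMap.pi_ext' fun w => LinearMap.ext_ring ?_
  have hsingle : laurentOfCoeffs K v (e + d) (Pi.single w 1) =
      Finsupp.single (v - w.toInt) 1 := by
    simp [laurentOfCoeffs, Finsupp.linearEquivFunOnFinite_symm_single, Finsupp.mapDomain_single]
  have hiff : ∀ t, v - w.toInt = v - s.toInt - t ↔ w.toInt - s.toInt = t := by
    intro t
    rw [sub_sub, sub_right_inj, sub_eq_iff_eq_add']
  simp only [LinearMap.comp_apply, LinearMap.coe_single, hsingle, eqFun, LinearMap.sum_apply,
    LinearMap.smul_apply, Finsupp.lapply_apply, Finsupp.single_apply, hiff, smul_eq_mul, mul_ite,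
    mul_one, mul_zero, Finset.sum_ite_eq, Matrix.mulVecLin_apply, LinearMap.proj_apply,
    Matrix.mulVec_single_one, Matrix.col_apply, eqMatrix, Matrix.of_apply, Pi.sub_apply]
  split_ifs with h
  · rfl
  · have : coeffZ F (w.toInt - s.toInt) = 0 := by
      refine if_neg fun h0 => h (mem_Dfin_iff.2 ⟨h0, ?_⟩)
      simp [Finset.sum_sub_distrib, ExpVec.sum_toInt]
    rw [this, mul_zero]

theorem Espace_eq_map_ker {K : Type*} [Field K] (F : MvPolynomial (Fin (2 + 1)) K)
    (d m e : ℕ) (v : Fin (2 + 1) → ℤ) :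
    Espace F d m v (e + d) = (LinearMap.ker (eqMatrix F m e (e + d) v).mulVecLin).map
      (laurentOfCoeffs K v (e + d)) := by
  have hmem : ∀ g, laurentOfCoeffs K v (e + d) g ∈ Espace F d m v (e + d) ↔
      g ∈ LinearMap.ker (eqMatrix F m e (e + d) v).mulVecLin := by
    intro g
    have hsupp : laurentOfCoeffs K v (e + d) g ∈ Finsupp.supported K K ↑(Dv v (e + d)) :=
      range_laurentOfCoeffs K v (e + d) ▸ LinearMap.mem_range_self _ g
    simp only [Espace, Submodule.mem_inf, hsupp, true_and, Submodule.mem_iInf,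
      LinearMap.mem_ker, Nat.add_sub_cancel, Matrix.mulVecLin_apply]
    simp only [← Finset.mem_coe, coe_Dfin_eq_range, Set.forall_mem_range, eqFun_laurentOfCoeffs,
      funext_iff, Prod.forall, Pi.zero_apply]
  ext G
  constructor
  · intro hG
    obtain ⟨g, rfl⟩ := (range_laurentOfCoeffs K v (e + d)).ge hG.1
    exact ⟨g, (hmem g).1 hG, rfl⟩
  · rintro ⟨g, hg, rfl⟩
    exact (hmem g).2 hg

theorem finrank_Espace_add_rank {K : Type*} [Field K] (F : MvPolynomial (Fin (2 + 1)) K)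
    (d m e : ℕ) (v : Fin (2 + 1) → ℤ) :
    Module.finrank K (Espace F d m v (e + d)) + (eqMatrix F m e (e + d) v).rank =
      Fintype.card (ExpVec (e + d)) := by
  rw [Espace_eq_map_ker, ← (Submodule.equivMapOfInjective _
    (laurentOfCoeffs_injective K v (e + d)) _).finrank_eq, Matrix.rank, add_comm,
    LinearMap.finrank_range_add_finrank_ker, Module.finrank_fintype_fun_eq_card]

theorem rank_eqMatrix_add {K : Type*} [Field K] (F : MvPolynomial (Fin (2 + 1)) K)
    (m e ℓ : ℕ) (v : Fin (2 + 1) → ℤ) :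
    (eqMatrix F m e ℓ v).rank +
      Module.finrank K (LinearMap.ker (eqMatrix F m e ℓ v).transpose.mulVecLin) =
        3 * Fintype.card (ExpVec e) := by
  rw [← Matrix.rank_transpose, Matrix.rank, LinearMap.finrank_range_add_finrank_ker,
    Module.finrank_fintype_fun_eq_card, Fintype.card_prod, Fintype.card_fin, mul_comm]

theorem card_le_finrank_ker_transpose {K : Type*} [Field K] (F : MvPolynomial (Fin (2 + 1)) K)
    (d m e : ℕ) {v : Fin (2 + 1) → ℤ} (hv : ∑ i, v i = ((d * m + (e + d) : ℕ) : ℤ)) :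
    Fintype.card (ExpVec e) ≤
      Module.finrank K (LinearMap.ker (eqMatrix F m e (e + d) v).transpose.mulVecLin) := by
  let ι : (ExpVec e → K) →ₗ[K] (ExpVec e × Fin (2 + 1) → K) := LinearMap.funLeft K K Prod.fst
  have hι : Function.Injective ι :=
    LinearMap.funLeft_injective_of_surjective _ _ _ Prod.fst_surjective
  have hker : LinearMap.range ι ≤
      LinearMap.ker (eqMatrix F m e (e + d) v).transpose.mulVecLin := by
    rintro _ ⟨c, rfl⟩
    rw [LinearMap.mem_ker]
    ext w
    rw [Matrix.mulVecLin_apply, Matrix.mulVec, dotProduct, Fintype.sum_prod_type]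
    refine Finset.sum_eq_zero fun s _ => ?_
    have hsum : ∑ i, (((v i - s.toInt i : ℤ) : K) -
        ((m : K) + 1) * ((w.toInt i - s.toInt i : ℤ) : K)) = 0 := by
      have : ∑ i, ((v i - s.toInt i) - ((m : ℤ) + 1) * (w.toInt i - s.toInt i)) = 0 := by
        rw [Finset.sum_sub_distrib, ← Finset.mul_sum, Finset.sum_sub_distrib,
          Finset.sum_sub_distrib, hv, s.sum_toInt, w.sum_toInt]
        push_cast
        ring
      exact_mod_cast congrArg (Int.cast : ℤ → K) this
    have hfactor : ∑ i, (eqMatrix F m e (e + d) v).transpose w (s, i) * ι c (s, i) =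
        (∑ i, (((v i - s.toInt i : ℤ) : K) -
          ((m : K) + 1) * ((w.toInt i - s.toInt i : ℤ) : K))) *
            (coeffZ F (w.toInt - s.toInt) * c s) := by
      rw [Finset.sum_mul]
      exact Finset.sum_congr rfl fun i _ => by
        simp only [Matrix.transpose_apply, eqMatrix, Matrix.of_apply, ι, LinearMap.funLeft_apply]
        ring
    rw [hfactor, hsum, zero_mul]
  calc Fintype.card (ExpVec e) = Module.finrank K (LinearMap.range ι) := by
        rw [LinearMap.finrank_range_of_inj hι, Module.finrank_fintype_fun_eq_card]
    _ ≤ _ := Submodule.finrank_mono hker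

theorem MvPolynomial.coeff_X_mul_pderiv {σ R : Type*} [CommSemiring R] (i : σ)
    (p : MvPolynomial σ R) (t : σ →₀ ℕ) : coeff t (X i * pderiv i p) = t i * coeff t p := by
  classical
  induction p using MvPolynomial.induction_on' with
  | monomial u a =>
    rw [X_mul_pderiv_monomial, coeff_smul, coeff_monomial]
    split_ifs with h
    · rw [h, nsmul_eq_mul]
    · simp
  | add p q hp hq => rw [map_add, mul_add, coeff_add, hp, hq, coeff_add, mul_add]

/-- A linear dependency among the rows of `eqMatrix`, written as a relation between `F` and its
logarithmic partial derivatives. -/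
theorem sum_sub_eq_zero_of_mem_ker_transpose {K : Type*} [Field K]
    {F : MvPolynomial (Fin (2 + 1)) K} {d m e : ℕ} (hd : d ≠ 0) (hF : F.IsHomogeneous d)
    {v : Fin (2 + 1) → ℤ} {c : ExpVec e × Fin (2 + 1) → K}
    (hc : c ∈ LinearMap.ker (eqMatrix F m e (e + d) v).transpose.mulVecLin) :
    ∑ i, (homogeneousOfCoeffs K e (fun s => c (s, i) * ((v i - s.toInt i : ℤ) : K)) * F -
      C ((m : K) + 1) * homogeneousOfCoeffs K e (fun s => c (s, i)) *
        (X i * pderiv i F)) = 0 := by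
  have hterm : ∀ i,
      homogeneousOfCoeffs K e (fun s => c (s, i) * ((v i - s.toInt i : ℤ) : K)) * F -
        C ((m : K) + 1) * homogeneousOfCoeffs K e (fun s => c (s, i)) * (X i * pderiv i F) =
      ∑ s : ExpVec e, monomial s.1 (c (s, i)) * (C ((v i - s.toInt i : ℤ) : K) * F -
        C ((m : K) + 1) * (X i * pderiv i F)) := by
    intro i
    simp only [homogeneousOfCoeffs_apply, mul_sub, Finset.sum_sub_distrib,
      Finset.sum_mul, Finset.mul_sum]
    refine congrArg₂ (· - ·) (Finset.sum_congr rfl fun s _ => ?_) ?_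
    · rw [← mul_assoc, mul_comm (monomial _ _) (C _), C_mul_monomial, mul_comm (c _)]
    · exact Finset.sum_congr rfl fun s _ => by ring
  have hhom : (∑ i, (homogeneousOfCoeffs K e
      (fun s => c (s, i) * ((v i - s.toInt i : ℤ) : K)) * F -
        C ((m : K) + 1) * homogeneousOfCoeffs K e (fun s => c (s, i)) *
          (X i * pderiv i F))).IsHomogeneous (e + d) := by
    refine IsHomogeneous.sum _ _ _ fun i _ => ?_
    refine ((isHomogeneous_homogeneousOfCoeffs _).mul hF).sub ?_
    exact ((isHomogeneous_homogeneousOfCoeffs _).C_mul _).mul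
      (isHomogeneous_X_mul_pderiv hd hF i)
  ext t
  rw [coeff_zero]
  by_cases ht : t.degree = e + d
  · let w : ExpVec (e + d) := ⟨t, mem_finsuppAntidiag_univ_iff.2 ht⟩
    have hw := congrFun (LinearMap.mem_ker.1 hc) w
    rw [Matrix.mulVecLin_apply, Matrix.mulVec, dotProduct, Fintype.sum_prod_type,
      Finset.sum_comm] at hw
    rw [coeff_sum]
    refine Eq.trans ?_ hw
    refine Finset.sum_congr rfl fun i _ => ?_
    rw [hterm, coeff_sum]
    refine Finset.sum_congr rfl fun s _ => ?_
    simp only [Matrix.transpose_apply, eqMatrix, Matrix.of_apply, coeffZ_toInt_sub]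
    rw [coeff_monomial_mul']
    change (if s.1 ≤ t then _ else _) = _ * (if s.1 ≤ t then _ else _) * _
    split_ifs with hst
    · rw [coeff_sub, coeff_C_mul, coeff_C_mul, coeff_X_mul_pderiv]
      have hcast : ((w.toInt i - s.toInt i : ℤ) : K) = ((t - s.1) i : ℕ) := by
        rw [Finsupp.tsub_apply, Nat.cast_sub (hst i)]
        simp [ExpVec.toInt, w]
      rw [hcast]
      ring
    · simp
  · exact hhom.coeff_eq_zero ht

/-- If the partial derivatives of `F` have no syzygies in degree `e < d`, a relation of this form
forces all the `A i` to agree. -/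
theorem eq_of_sum_sub_eq_zero {K : Type*} [Field K] {F : MvPolynomial (Fin (2 + 1)) K}
    {d e : ℕ} (hed : e < d) (hdK : (d : K) ≠ 0) {μ : K} (hμ : μ ≠ 0)
    (hF : F.IsHomogeneous d)
    (hnd : ∀ x : Fin (2 + 1) → AlgebraicClosure K,
      (∀ i, aeval x (X i * pderiv i F) = 0) → x = 0)
    {A B : Fin (2 + 1) → MvPolynomial (Fin (2 + 1)) K} (hA : ∀ i, (A i).IsHomogeneous e)
    (hB : ∀ i, (B i).IsHomogeneous e)
    (h : ∑ i, (B i * F - C μ * A i * (X i * pderiv i F)) = 0) (i j : Fin (2 + 1)) :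
    A i = A j := by
  have hsyz := eq_zero_of_sum_mul_X_mul_pderiv_eq_zero hed hF hnd
    (a := fun i => ∑ j, B j - C ((d : K) * μ) * A i)
    (fun i => (IsHomogeneous.sum _ _ _ fun j _ => hB j).sub ((hA i).C_mul _)) (by
      have heuler := hF.sum_X_mul_pderiv
      rw [Finset.sum_sub_distrib, ← Finset.sum_mul] at h
      simp only [sub_mul, Finset.sum_sub_distrib]
      rw [← Finset.mul_sum, heuler, nsmul_eq_mul, C_mul, map_natCast]
      simp only [mul_assoc (d : MvPolynomial (Fin (2 + 1)) K)]
      rw [← Finset.mul_sum]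
      linear_combination (d : MvPolynomial (Fin (2 + 1)) K) * h)
  have hC : C ((d : K) * μ) ≠ (0 : MvPolynomial (Fin (2 + 1)) K) :=
    C_ne_zero.2 (mul_ne_zero hdK hμ)
  refine mul_left_cancel₀ hC ?_
  linear_combination hsyz j - hsyz i

theorem finrank_ker_transpose_le {K : Type*} [Field K] {F : MvPolynomial (Fin (2 + 1)) K}
    {d m e : ℕ} (hed : e < d) (hdK : (d : K) ≠ 0) (hm : (m : K) + 1 ≠ 0)
    (hF : F.IsHomogeneous d)
    (hnd : ∀ x : Fin (2 + 1) → AlgebraicClosure K,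
      (∀ i, aeval x (X i * pderiv i F) = 0) → x = 0) (v : Fin (2 + 1) → ℤ) :
    Module.finrank K (LinearMap.ker (eqMatrix F m e (e + d) v).transpose.mulVecLin) ≤
      Fintype.card (ExpVec e) := by
  have hd : d ≠ 0 := by omega
  let ρ : (ExpVec e × Fin (2 + 1) → K) →ₗ[K] (ExpVec e → K) :=
    LinearMap.funLeft K K fun s => (s, 0)
  suffices hinj : Function.Injective
      (ρ.domRestrict (LinearMap.ker (eqMatrix F m e (e + d) v).transpose.mulVecLin)) by
    simpa using LinearMap.finrank_le_finrank_of_injective hinj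
  rw [← LinearMap.ker_eq_bot, LinearMap.ker_eq_bot']
  rintro ⟨c, hc⟩ hρ
  rw [Subtype.ext_iff]
  have hc0 : ∀ s, c (s, 0) = 0 := fun s => congrFun hρ s
  have hA0 : homogeneousOfCoeffs K e (fun s => c (s, 0)) = 0 := by
    have : (fun s => c (s, 0)) = 0 := funext hc0
    rw [this, map_zero]
  ext ⟨s, i⟩
  have hA : homogeneousOfCoeffs K e (fun s => c (s, i)) = 0 :=
    (eq_of_sum_sub_eq_zero hed hdK hm hF hnd (fun i => isHomogeneous_homogeneousOfCoeffs _)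
      (fun i => isHomogeneous_homogeneousOfCoeffs _)
      (sum_sub_eq_zero_of_mem_ker_transpose hd hF hc) i 0).trans hA0
  refine (coeff_homogeneousOfCoeffs (fun s => c (s, i)) s).symm.trans ?_
  rw [hA]
  exact coeff_zero _

/-- Corollary 3.9: for `n = 2`, `ℓ ∈ {2d-2, 2d-1}`, and `v ∈ ℤ³` of degree `dm + ℓ`, we
have `dim_K ℰ_{v,ℓ} ≥ d²`; if moreover `F` is nondegenerate and `m + 1 ≠ 0` in `K`, then
`dim_K ℰ_{v,ℓ} = b_ℓ + b_{ℓ-d} = d²`. -/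
theorem dim_Espace_eq_d_sq {K : Type*} [Field K]
    (d : ℕ) (hd : 2 ≤ d) (hdK : (d : K) ≠ 0)
    (F : MvPolynomial (Fin (2 + 1)) K) (hF : F.IsHomogeneous d)
    (ℓ : ℕ) (hℓ : ℓ = 2 * d - 2 ∨ ℓ = 2 * d - 1)
    (m : ℕ) (v : Fin (2 + 1) → ℤ) (hv : (∑ i, v i) = ((d * m + ℓ : ℕ) : ℤ)) :
    ((d ^ 2 : ℕ) : Cardinal) ≤ Module.rank K ↥(Espace F d m v ℓ)
    ∧ ((∀ x : Fin (2 + 1) → AlgebraicClosure K,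
          (∀ i, MvPolynomial.aeval x (X i * pderiv i F) = 0) → x = 0) →
        ((m : K) + 1) ≠ 0 →
        Module.rank K ↥(Espace F d m v ℓ)
            = ((bdim F ℓ + bdim F (ℓ - d) : ℕ) : Cardinal)
          ∧ bdim F ℓ + bdim F (ℓ - d) = d ^ 2) := by
  obtain ⟨e, hed, hℓe, hcard⟩ : ∃ e, e < d ∧ ℓ = e + d ∧
      d ^ 2 + 2 * Fintype.card (ExpVec e) = Fintype.card (ExpVec (e + d)) := by
    obtain ⟨c, rfl⟩ := Nat.exists_eq_add_of_le' hd
    rcases hℓ with h | h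
    · refine ⟨c, by omega, by omega, ?_⟩
      linarith [two_mul_card_expVec c, two_mul_card_expVec (c + (c + 2))]
    · refine ⟨c + 1, by omega, by omega, ?_⟩
      linarith [two_mul_card_expVec (c + 1), two_mul_card_expVec (c + 1 + (c + 2))]
  subst hℓe
  have hfin : Module.Finite K (Espace F d m v (e + d)) := by
    rw [Espace_eq_map_ker]
    infer_instance
  have hdim := finrank_Espace_add_rank F d m e v
  have hrank := rank_eqMatrix_add F m e (e + d) v
  have hlow := card_le_finrank_ker_transpose F d m e hv
  rw [← Module.finrank_eq_rank]
  refine ⟨by exact_mod_cast (by omega), fun hnd hm => ?_⟩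
  have hup := finrank_ker_transpose_le (v := v) hed hdK hm hF hnd
  have hb := bdim_add_three_mul hed hF hnd
  have hb' := bdim_of_lt hed hF
  rw [Nat.add_sub_cancel]
  exact ⟨by exact_mod_cast (by omega), by omega⟩
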